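/- All resolutions of a monad induce equivalent categories of coalgebras: if B and D are idempotent complete and there is an isomorphism of monads T₁ ≅ T₂ on A, then the Eilenberg–Moore categories Coalg(W₁) and Coalg(W₂) are equivalent. Dually, if two adjunctions into a common category induce isomorphic comonads, then the Eilenberg–Moore categories of algebras for the two induced monads are equivalent. -/

import Mathlib

open CategoryTheory

namespace CategoryTheory

section

variable {C : Type*} [Category C] (T : Monad C)

namespace Monad

lemma adj_counit_app_f (X : T.Algebra) : (T.adj.counit.app X).f = X.a := by
  simp; rfl

lemma adj_toComonad_δ_app_f (X : T.Algebra) :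
    (T.adj.toComonad.δ.app X).f = T.map (T.η.app X.A) :=
  congrArg T.map (by simp; rfl)

/-- Constructor for coalgebras over the comonad on `T.Algebra`. -/
def coalgebraMk (X : T.Algebra) (c : X.A ⟶ T.obj X.A) (h : T.map c ≫ T.μ.app X.A = X.a ≫ c)
    (counit : c ≫ X.a = 𝟙 X.A) (coassoc : c ≫ T.map (T.η.app X.A) = c ≫ T.map c) :
    T.adj.toComonad.Coalgebra where
  A := X
  a := { f := c, h := h }
  counit := by
    ext
    exact (congrArg (c ≫ ·) (T.adj_counit_app_f X)).trans counit
  coassoc := by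
    ext
    exact (congrArg (c ≫ ·) (T.adj_toComonad_δ_app_f X)).trans coassoc

variable {T}

lemma coalgebra_counit (X : T.adj.toComonad.Coalgebra) : X.a.f ≫ X.A.a = 𝟙 X.A.A :=
  (congrArg (X.a.f ≫ ·) (T.adj_counit_app_f X.A)).symm.trans
    (congrArg Monad.Algebra.Hom.f X.counit)

lemma coalgebra_coassoc (X : T.adj.toComonad.Coalgebra) :
    X.a.f ≫ T.map (T.η.app X.A.A) = X.a.f ≫ T.map X.a.f :=
  (congrArg (X.a.f ≫ ·) (T.adj_toComonad_δ_app_f X.A)).symm.trans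
    (congrArg Monad.Algebra.Hom.f X.coassoc)

lemma coalgebra_a_h (X : T.adj.toComonad.Coalgebra) :
    T.map X.a.f ≫ T.μ.app X.A.A = X.A.a ≫ X.a.f :=
  X.a.h

lemma coalgebraHom_h {X Y : T.adj.toComonad.Coalgebra} (f : X ⟶ Y) :
    X.a.f ≫ T.map f.f.f = f.f.f ≫ Y.a.f :=
  congrArg Monad.Algebra.Hom.f f.h

/-- Constructor for morphisms of coalgebras over the comonad on `T.Algebra`. -/
def coalgebraHomMk {X Y : T.adj.toComonad.Coalgebra} (f : X.A.A ⟶ Y.A.A)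
    (h : T.map f ≫ Y.A.a = X.A.a ≫ f) (h' : X.a.f ≫ T.map f = f ≫ Y.a.f) : X ⟶ Y where
  f := { f := f, h := h }
  h := by ext; exact h'

end Monad

end

namespace Adjunction

variable {A B : Type*} [Category A] [Category B] {L : A ⥤ B} {R : B ⥤ A} (adj : L ⊣ R)

/-- For `T` the monad induced by `L ⊣ R`, the functor from coalgebras over the
comonad induced by `L ⊣ R` to coalgebras over the comonad on `T.Algebra`. -/
def coalgebraComparison : adj.toComonad.Coalgebra ⥤ adj.toMonad.adj.toComonad.Coalgebra where
  obj Y := Monad.coalgebraMk _ ((Monad.comparison adj).obj Y.A) (R.map Y.a)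
    ((Monad.comparison adj).map Y.a).h
    ((R.map_comp _ _).symm.trans ((congrArg R.map Y.counit).trans (R.map_id _)))
    ((R.map_comp _ _).symm.trans ((congrArg R.map Y.coassoc).trans (R.map_comp _ _)))
  map {Y Z} f := Monad.coalgebraHomMk (R.map f.f) ((Monad.comparison adj).map f.f).h
    ((R.map_comp _ _).symm.trans ((congrArg R.map f.h).trans (R.map_comp _ _)))
  map_id _ := by ext; exact R.map_id _
  map_comp _ _ := by ext; exact R.map_comp _ _

lemma coalgebraHom_eq {Y Z : adj.toComonad.Coalgebra} (f : Y ⟶ Z) :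
    f.f = (show Y.A ⟶ L.obj (R.obj Y.A) from Y.a) ≫ L.map (R.map f.f) ≫ adj.counit.app Z.A := by
  let c : Y.A ⟶ L.obj (R.obj Y.A) := Y.a
  let d : Z.A ⟶ L.obj (R.obj Z.A) := Z.a
  have h : c ≫ L.map (R.map f.f) = f.f ≫ d := f.h
  have h' : d ≫ adj.counit.app Z.A = 𝟙 _ := Z.counit
  change f.f = c ≫ _
  rw [reassoc_of% h, h', Category.comp_id]

instance : adj.coalgebraComparison.Faithful where
  map_injective {Y Z} f g h := by
    have h' : R.map f.f = R.map g.f := congrArg (fun k ↦ k.f.f) h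
    ext
    rw [coalgebraHom_eq, coalgebraHom_eq adj g, h']

instance : adj.coalgebraComparison.Full where
  map_surjective {Y Z} g := by
    let g' : R.obj Y.A ⟶ R.obj Z.A := g.f.f
    let c : Y.A ⟶ L.obj (R.obj Y.A) := Y.a
    let d : Z.A ⟶ L.obj (R.obj Z.A) := Z.a
    have h₁ : R.map (L.map g') ≫ R.map (adj.counit.app Z.A) =
      R.map (adj.counit.app Y.A) ≫ g' := g.f.h
    have h₂ : R.map c ≫ R.map (L.map g') = g' ≫ R.map d := Monad.coalgebraHom_h g
    have h₃ : c ≫ adj.counit.app Y.A = 𝟙 Y.A := Y.counit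
    refine ⟨{ f := c ≫ L.map g' ≫ adj.counit.app Z.A, h := ?_ }, ?_⟩
    · change c ≫ L.map (R.map (c ≫ L.map g' ≫ adj.counit.app Z.A)) =
        (c ≫ L.map g' ≫ adj.counit.app Z.A) ≫ d
      have h₄ : R.map (c ≫ L.map g' ≫ adj.counit.app Z.A) = g' := by
        rw [R.map_comp, R.map_comp, h₁, ← R.map_comp_assoc, h₃]
        simp
      have h₅ : adj.counit.app Z.A ≫ d = L.map (R.map d) ≫ adj.counit.app _ := by simp
      rw [h₄, Category.assoc, Category.assoc, h₅, ← L.map_comp_assoc, ← h₂, L.map_comp_assoc,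
        adj.counit_naturality, adj.counit_naturality_assoc, reassoc_of% h₃]
    · ext
      change R.map (c ≫ L.map g' ≫ adj.counit.app Z.A) = g'
      rw [R.map_comp, R.map_comp, h₁, ← R.map_comp_assoc, h₃]
      simp

instance [IsIdempotentComplete B] : adj.coalgebraComparison.EssSurj where
  mem_essImage X := by
    let x : A := X.A.A
    let α : R.obj (L.obj x) ⟶ x := X.A.a
    let c : x ⟶ R.obj (L.obj x) := X.a.f
    have h₁ : c ≫ α = 𝟙 x := Monad.coalgebra_counit X
    have h₂ : c ≫ R.map (L.map (adj.unit.app x)) = c ≫ R.map (L.map c) :=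
      Monad.coalgebra_coassoc X
    have h₃ : R.map (L.map c) ≫ R.map (adj.counit.app (L.obj x)) = α ≫ c :=
      Monad.coalgebra_a_h X
    have h₄ : R.map (adj.counit.app (L.obj x)) ≫ α = R.map (L.map α) ≫ α := X.A.assoc
    obtain ⟨b, ι, π, h₅, h₆⟩ := IsIdempotentComplete.idempotents_split (L.obj x)
      (L.map c ≫ adj.counit.app (L.obj x)) (by
        rw [Category.assoc, ← adj.counit_naturality, ← L.map_comp_assoc, R.map_comp, h₃,
          reassoc_of% h₁])
    have h₇ : R.map π ≫ R.map ι = α ≫ c := by rw [← R.map_comp, h₆, R.map_comp, h₃]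
    have h₈ : R.map ι ≫ R.map π = 𝟙 _ := by rw [← R.map_comp, h₅, R.map_id]
    let e : R.obj b ≅ x :=
      { hom := R.map ι ≫ α
        inv := c ≫ R.map π
        hom_inv_id := by
          rw [Category.assoc, ← reassoc_of% h₇, h₈, Category.comp_id, h₈]
        inv_hom_id := by
          rw [Category.assoc, reassoc_of% h₇, reassoc_of% h₁, h₁] }
    have hπ : L.map (R.map π) ≫ adj.counit.app b = adj.counit.app (L.obj x) ≫ π :=
      adj.counit_naturality π
    have hι : L.map (R.map ι) ≫ adj.counit.app (L.obj x) = adj.counit.app b ≫ ι :=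
      adj.counit_naturality ι
    have h₉ : c ≫ R.map π ≫ R.map ι = c := by rw [h₇, reassoc_of% h₁]
    have h₁₀ : ι ≫ L.map c = ι ≫ L.map (adj.unit.app x) := by
      have : Epi π := (SplitEpi.mk ι h₅).epi
      rw [← cancel_epi π, reassoc_of% h₆, reassoc_of% h₆, ← adj.counit_naturality,
        ← adj.counit_naturality, ← L.map_comp_assoc, ← L.map_comp_assoc, h₂]
    let Y : adj.toComonad.Coalgebra :=
      { A := b
        a := ι ≫ L.map (c ≫ R.map π)
        counit := by
          change (ι ≫ L.map (c ≫ R.map π)) ≫ adj.counit.app b = 𝟙 b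
          rw [L.map_comp, Category.assoc, Category.assoc, hπ,
            ← reassoc_of% h₆, h₅, Category.comp_id, h₅]
        coassoc := by
          change (ι ≫ L.map (c ≫ R.map π)) ≫ L.map (adj.unit.app (R.obj b)) =
            (ι ≫ L.map (c ≫ R.map π)) ≫ L.map (R.map (ι ≫ L.map (c ≫ R.map π)))
          have h₁₁ : c ≫ R.map π ≫ R.map (ι ≫ L.map (c ≫ R.map π)) =
              c ≫ R.map (L.map c) ≫ R.map (L.map (R.map π)) := by
            rw [R.map_comp, reassoc_of% h₉, L.map_comp, R.map_comp]
          rw [Category.assoc, Category.assoc, ← L.map_comp, ← L.map_comp, Category.assoc,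
            Category.assoc, h₁₁, ← reassoc_of% h₂, ← adj.unit_naturality, L.map_comp,
            reassoc_of% h₁₀, L.map_comp c, reassoc_of% h₁₀, ← L.map_comp, ← L.map_comp,
            adj.unit_naturality_assoc] }
    refine ⟨Y, ⟨Comonad.Coalgebra.isoMk (Monad.Algebra.isoMk e ?_) ?_⟩⟩
    · change R.map (L.map (R.map ι ≫ α)) ≫ α = R.map (adj.counit.app b) ≫ R.map ι ≫ α
      rw [L.map_comp, R.map_comp, Category.assoc, ← h₄, ← R.map_comp_assoc,
        hι, R.map_comp_assoc]
    · ext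
      change R.map (ι ≫ L.map (c ≫ R.map π)) ≫ R.map (L.map (R.map ι ≫ α)) = (R.map ι ≫ α) ≫ c
      rw [R.map_comp, Category.assoc, ← R.map_comp, ← L.map_comp, Category.assoc, reassoc_of% h₇,
        reassoc_of% h₁, h₁, Category.assoc, ← h₇, reassoc_of% h₈]
      simp
end Adjunction

namespace Monad

variable {C : Type*} [Category C] {S T : Monad C}

/-- An isomorphism of monads `S ≅ T` transports coalgebras over the comonad on `S.Algebra` to
coalgebras over the comonad on `T.Algebra`. -/
def coalgebraFunctorOfMonadIso (h : S ≅ T) :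
    S.adj.toComonad.Coalgebra ⥤ T.adj.toComonad.Coalgebra where
  obj X :=
    letI s : X.A.A ⟶ S.obj X.A.A := X.a.f
    haveI e (x : C) : h.hom.app x ≫ h.inv.app x = 𝟙 _ := (MonadIso.toNatIso h).hom_inv_id_app x
    haveI e' (x : C) : h.inv.app x ≫ h.hom.app x = 𝟙 _ := (MonadIso.toNatIso h).inv_hom_id_app x
    coalgebraMk _ ((Monad.algebraFunctorOfMonadHom h.inv).obj X.A) (s ≫ h.hom.app X.A.A)
      (by
        have h₁ : S.map s ≫ S.μ.app X.A.A = X.A.a ≫ s := coalgebra_a_h X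
        have h₂ := h.inv.naturality s
        have h₃ := h.inv.naturality (h.hom.app X.A.A)
        change T.map (s ≫ h.hom.app X.A.A) ≫ T.μ.app X.A.A =
          (h.inv.app X.A.A ≫ X.A.a) ≫ s ≫ h.hom.app X.A.A
        rw [Category.assoc, ← reassoc_of% h₁, h.hom.app_μ, ← reassoc_of% h₂, Category.assoc,
          ← reassoc_of% h₃, reassoc_of% e', T.map_comp, Category.assoc])
      (by
        change (s ≫ h.hom.app X.A.A) ≫ h.inv.app X.A.A ≫ X.A.a = 𝟙 X.A.A
        rw [Category.assoc, reassoc_of% e]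
        exact coalgebra_counit X)
      (by
        have h₁ : s ≫ S.map (S.η.app X.A.A) = s ≫ S.map s := coalgebra_coassoc X
        have h₂ := h.hom.naturality s
        have h₃ := h.hom.naturality (S.η.app X.A.A)
        change (s ≫ h.hom.app X.A.A) ≫ T.map (T.η.app X.A.A) =
          (s ≫ h.hom.app X.A.A) ≫ T.map (s ≫ h.hom.app X.A.A)
        rw [T.map_comp, Category.assoc, Category.assoc, ← reassoc_of% h₂, ← reassoc_of% h₁,
          reassoc_of% h₃, ← T.map_comp, h.hom.app_η])
  map {X Y} f := coalgebraHomMk f.f.f ((Monad.algebraFunctorOfMonadHom h.inv).map f.f).h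
    (by
      let s : X.A.A ⟶ S.obj X.A.A := X.a.f
      let s' : Y.A.A ⟶ S.obj Y.A.A := Y.a.f
      have h₁ : s ≫ S.map f.f.f = f.f.f ≫ s' := coalgebraHom_h f
      have h₂ := h.hom.naturality f.f.f
      change (s ≫ h.hom.app X.A.A) ≫ T.map f.f.f = f.f.f ≫ s' ≫ h.hom.app Y.A.A
      rw [Category.assoc, ← h₂, reassoc_of% h₁])

/-- Constructor for isomorphisms of coalgebras over the comonad on `T.Algebra`. -/
def coalgebraIsoMk {X Y : T.adj.toComonad.Coalgebra} (e : X.A.A ≅ Y.A.A)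
    (h : T.map e.hom ≫ Y.A.a = X.A.a ≫ e.hom) (h' : X.a.f ≫ T.map e.hom = e.hom ≫ Y.a.f) :
    X ≅ Y :=
  Comonad.Coalgebra.isoMk (Monad.Algebra.isoMk e h) (by ext; exact h')

/-- Isomorphic monads have equivalent categories of coalgebras over their categories of algebras. -/
def coalgebraEquivOfMonadIso (h : S ≅ T) :
    S.adj.toComonad.Coalgebra ≌ T.adj.toComonad.Coalgebra where
  functor := coalgebraFunctorOfMonadIso h
  inverse := coalgebraFunctorOfMonadIso h.symm
  unitIso := NatIso.ofComponents
    (fun X ↦ coalgebraIsoMk (Iso.refl X.A.A)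
      (by
        have e : h.hom.app X.A.A ≫ h.inv.app X.A.A = 𝟙 _ :=
          (MonadIso.toNatIso h).hom_inv_id_app X.A.A
        change S.map (𝟙 X.A.A) ≫ h.hom.app X.A.A ≫ h.inv.app X.A.A ≫ X.A.a = X.A.a ≫ 𝟙 _
        rw [reassoc_of% e]
        simp)
      (by
        let s : X.A.A ⟶ S.obj X.A.A := X.a.f
        have e : h.hom.app X.A.A ≫ h.inv.app X.A.A = 𝟙 _ :=
          (MonadIso.toNatIso h).hom_inv_id_app X.A.A
        change s ≫ S.map (𝟙 X.A.A) = 𝟙 X.A.A ≫ (s ≫ h.hom.app X.A.A) ≫ h.inv.app X.A.A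
        rw [Category.assoc, e]
        simp))
    (fun f ↦ by
      ext
      exact (Category.comp_id _).trans (Category.id_comp _).symm)
  counitIso := NatIso.ofComponents
    (fun X ↦ coalgebraIsoMk (Iso.refl X.A.A)
      (by
        have e : h.inv.app X.A.A ≫ h.hom.app X.A.A = 𝟙 _ :=
          (MonadIso.toNatIso h).inv_hom_id_app X.A.A
        change T.map (𝟙 X.A.A) ≫ X.A.a = (h.inv.app X.A.A ≫ h.hom.app X.A.A ≫ X.A.a) ≫ 𝟙 _
        rw [reassoc_of% e]
        simp)
      (by
        let s : X.A.A ⟶ T.obj X.A.A := X.a.f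
        have e : h.inv.app X.A.A ≫ h.hom.app X.A.A = 𝟙 _ :=
          (MonadIso.toNatIso h).inv_hom_id_app X.A.A
        change ((s ≫ h.inv.app X.A.A) ≫ h.hom.app X.A.A) ≫ T.map (𝟙 X.A.A) = 𝟙 X.A.A ≫ s
        rw [Category.assoc, Category.assoc, reassoc_of% e]
        simp))
    (fun f ↦ by
      ext
      exact (Category.comp_id _).trans (Category.id_comp _).symm)
  functor_unitIso_comp X := by
    ext
    exact Category.comp_id _

end Monad

namespace Comonad

variable {C : Type*} [Category C] (G : Comonad C)

lemma adj_unit_app_f (X : G.Coalgebra) : (G.adj.unit.app X).f = X.a := by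
  simp; rfl

lemma adj_toMonad_μ_app_f (X : G.Coalgebra) :
    (G.adj.toMonad.μ.app X).f = G.map (G.ε.app X.A) :=
  congrArg G.map (by simp; rfl)

/-- Constructor for algebras over the monad on `G.Coalgebra`. -/
def algebraMk (X : G.Coalgebra) (α : G.obj X.A ⟶ X.A) (h : G.δ.app X.A ≫ G.map α = α ≫ X.a)
    (unit : X.a ≫ α = 𝟙 X.A) (assoc : G.map (G.ε.app X.A) ≫ α = G.map α ≫ α) :
    G.adj.toMonad.Algebra where
  A := X
  a := { f := α, h := h }
  unit := by
    ext
    exact (congrArg (· ≫ α) (G.adj_unit_app_f X)).trans unit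
  assoc := by
    ext
    exact (congrArg (· ≫ α) (G.adj_toMonad_μ_app_f X)).trans assoc

variable {G}

lemma algebra_unit (X : G.adj.toMonad.Algebra) : X.A.a ≫ X.a.f = 𝟙 X.A.A :=
  (congrArg (· ≫ X.a.f) (G.adj_unit_app_f X.A)).symm.trans
    (congrArg Comonad.Coalgebra.Hom.f X.unit)

lemma algebra_assoc (X : G.adj.toMonad.Algebra) :
    G.map (G.ε.app X.A.A) ≫ X.a.f = G.map X.a.f ≫ X.a.f :=
  (congrArg (· ≫ X.a.f) (G.adj_toMonad_μ_app_f X.A)).symm.trans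
    (congrArg Comonad.Coalgebra.Hom.f X.assoc)

lemma algebra_a_h (X : G.adj.toMonad.Algebra) :
    G.δ.app X.A.A ≫ G.map X.a.f = X.a.f ≫ X.A.a :=
  X.a.h

lemma algebraHom_h {X Y : G.adj.toMonad.Algebra} (f : X ⟶ Y) :
    G.map f.f.f ≫ Y.a.f = X.a.f ≫ f.f.f :=
  congrArg Comonad.Coalgebra.Hom.f f.h

/-- Constructor for morphisms of algebras over the monad on `G.Coalgebra`. -/
def algebraHomMk {X Y : G.adj.toMonad.Algebra} (f : X.A.A ⟶ Y.A.A)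
    (h : X.A.a ≫ G.map f = f ≫ Y.A.a) (h' : G.map f ≫ Y.a.f = X.a.f ≫ f) : X ⟶ Y where
  f := { f := f, h := h }
  h := by ext; exact h'

/-- Constructor for isomorphisms of algebras over the monad on `G.Coalgebra`. -/
def algebraIsoMk {X Y : G.adj.toMonad.Algebra} (e : X.A.A ≅ Y.A.A)
    (h : X.A.a ≫ G.map e.hom = e.hom ≫ Y.A.a) (h' : G.map e.hom ≫ Y.a.f = X.a.f ≫ e.hom) :
    X ≅ Y :=
  Monad.Algebra.isoMk (Comonad.Coalgebra.isoMk e h) (by ext; exact h')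

end Comonad

namespace Adjunction

variable {A B : Type*} [Category A] [Category B] {L : A ⥤ B} {R : B ⥤ A} (adj : L ⊣ R)

/-- For `G` the comonad induced by `L ⊣ R`, the functor from algebras over the
monad induced by `L ⊣ R` to algebras over the monad on `G.Coalgebra`. -/
def algebraComparison : adj.toMonad.Algebra ⥤ adj.toComonad.adj.toMonad.Algebra where
  obj Y := Comonad.algebraMk _ ((Comonad.comparison adj).obj Y.A) (L.map Y.a)
    ((Comonad.comparison adj).map Y.a).h
    ((L.map_comp _ _).symm.trans ((congrArg L.map Y.unit).trans (L.map_id _)))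
    ((L.map_comp _ _).symm.trans ((congrArg L.map Y.assoc).trans (L.map_comp _ _)))
  map {Y Z} f := Comonad.algebraHomMk (L.map f.f) ((Comonad.comparison adj).map f.f).h
    ((L.map_comp _ _).symm.trans ((congrArg L.map f.h).trans (L.map_comp _ _)))
  map_id _ := by ext; exact L.map_id _
  map_comp _ _ := by ext; exact L.map_comp _ _

lemma algebraHom_eq {Y Z : adj.toMonad.Algebra} (f : Y ⟶ Z) :
    f.f = adj.unit.app Y.A ≫ R.map (L.map f.f) ≫ (show R.obj (L.obj Z.A) ⟶ Z.A from Z.a) := by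
  let c : R.obj (L.obj Y.A) ⟶ Y.A := Y.a
  let d : R.obj (L.obj Z.A) ⟶ Z.A := Z.a
  have h : R.map (L.map f.f) ≫ d = c ≫ f.f := f.h
  have h' : adj.unit.app Y.A ≫ c = 𝟙 _ := Y.unit
  change f.f = _ ≫ _ ≫ d
  rw [h, reassoc_of% h']

instance : adj.algebraComparison.Faithful where
  map_injective {Y Z} f g h := by
    have h' : L.map f.f = L.map g.f := congrArg (fun k ↦ k.f.f) h
    ext
    rw [algebraHom_eq, algebraHom_eq adj g, h']

instance : adj.algebraComparison.Full where
  map_surjective {Y Z} g := by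
    let g' : L.obj Y.A ⟶ L.obj Z.A := g.f.f
    let c : R.obj (L.obj Y.A) ⟶ Y.A := Y.a
    let d : R.obj (L.obj Z.A) ⟶ Z.A := Z.a
    have h₁ : L.map (adj.unit.app Y.A) ≫ L.map (R.map g') =
      g' ≫ L.map (adj.unit.app Z.A) := g.f.h
    have h₂ : L.map (R.map g') ≫ L.map d = L.map c ≫ g' := Comonad.algebraHom_h g
    have h₃ : adj.unit.app Z.A ≫ d = 𝟙 Z.A := Z.unit
    have h₄ : L.map (adj.unit.app Y.A ≫ R.map g' ≫ d) = g' := by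
      rw [L.map_comp, L.map_comp, reassoc_of% h₁, ← L.map_comp, h₃]
      simp
    refine ⟨{ f := adj.unit.app Y.A ≫ R.map g' ≫ d, h := ?_ }, ?_⟩
    · change R.map (L.map (adj.unit.app Y.A ≫ R.map g' ≫ d)) ≫ d =
        c ≫ adj.unit.app Y.A ≫ R.map g' ≫ d
      have h₅ : c ≫ adj.unit.app Y.A = adj.unit.app _ ≫ R.map (L.map c) := by simp
      rw [h₄, reassoc_of% h₅, ← R.map_comp_assoc, ← h₂, R.map_comp_assoc,
        adj.unit_naturality_assoc, adj.unit_naturality_assoc, h₃, Category.comp_id]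
    · ext
      exact h₄

instance [IsIdempotentComplete A] : adj.algebraComparison.EssSurj where
  mem_essImage X := by
    let x : B := X.A.A
    let c : x ⟶ L.obj (R.obj x) := X.A.a
    let α : L.obj (R.obj x) ⟶ x := X.a.f
    have h₁ : c ≫ α = 𝟙 x := Comonad.algebra_unit X
    have h₂ : L.map (R.map (adj.counit.app x)) ≫ α = L.map (R.map α) ≫ α :=
      Comonad.algebra_assoc X
    have h₃ : L.map (adj.unit.app (R.obj x)) ≫ L.map (R.map α) = α ≫ c :=
      Comonad.algebra_a_h X
    obtain ⟨b, ι, π, h₅, h₆⟩ := IsIdempotentComplete.idempotents_split (R.obj x)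
      (adj.unit.app (R.obj x) ≫ R.map α) (by
        have h := (adj.unit_naturality (adj.unit.app (R.obj x) ≫ R.map α)).symm
        rw [Category.assoc] at h
        rw [Category.assoc, reassoc_of% h, ← R.map_comp, L.map_comp, Category.assoc,
          reassoc_of% h₃, h₁, Category.comp_id])
    have h₇ : L.map π ≫ L.map ι = α ≫ c := by rw [← L.map_comp, h₆, L.map_comp, h₃]
    have h₈ : L.map ι ≫ L.map π = 𝟙 _ := by rw [← L.map_comp, h₅, L.map_id]
    let e : L.obj b ≅ x :=
      { hom := L.map ι ≫ α
        inv := c ≫ L.map π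
        hom_inv_id := by
          rw [Category.assoc, ← reassoc_of% h₇, h₈, Category.comp_id, h₈]
        inv_hom_id := by
          rw [Category.assoc, reassoc_of% h₇, reassoc_of% h₁, h₁] }
    have hι : ι ≫ adj.unit.app (R.obj x) = adj.unit.app b ≫ R.map (L.map ι) :=
      (adj.unit_naturality ι).symm
    have h₉ : L.map π ≫ L.map ι ≫ α = α := by rw [reassoc_of% h₇, h₁, Category.comp_id]
    have h₁₀ : R.map α ≫ π = R.map (adj.counit.app x) ≫ π := by
      have : Mono ι := (SplitMono.mk π h₅).mono
      have hα := adj.unit_naturality (R.map α)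
      have hε := adj.unit_naturality (R.map (adj.counit.app x))
      rw [← cancel_mono ι, Category.assoc, Category.assoc, h₆, ← reassoc_of% hα,
        ← reassoc_of% hε, ← R.map_comp, ← R.map_comp, h₂]
    let Y : adj.toMonad.Algebra :=
      { A := b
        a := R.map (L.map ι ≫ α) ≫ π
        unit := by
          change adj.unit.app b ≫ R.map (L.map ι ≫ α) ≫ π = 𝟙 b
          rw [R.map_comp, Category.assoc, ← reassoc_of% hι, ← reassoc_of% h₆, h₅,
            Category.comp_id, h₅]
        assoc := by
          change R.map (adj.counit.app (L.obj b)) ≫ R.map (L.map ι ≫ α) ≫ π =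
            R.map (L.map (R.map (L.map ι ≫ α) ≫ π)) ≫ R.map (L.map ι ≫ α) ≫ π
          have hLι := adj.counit_naturality (L.map ι)
          have hε : R.map (L.map (R.map (adj.counit.app x))) ≫ R.map (adj.counit.app x) =
              R.map (adj.counit.app (L.obj (R.obj x))) ≫ R.map (adj.counit.app x) := by
            rw [← R.map_comp, ← R.map_comp]
            exact congrArg R.map (adj.counit_naturality _)
          have h₁₁ : L.map (R.map (L.map ι ≫ α) ≫ π) ≫ L.map ι ≫ α =
              L.map (R.map (L.map ι)) ≫ L.map (R.map α) ≫ α := by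
            rw [L.map_comp, Category.assoc, h₉, R.map_comp, L.map_comp, Category.assoc]
          rw [← R.map_comp_assoc, ← R.map_comp_assoc, h₁₁, ← h₂, ← reassoc_of% hLι]
          simp only [R.map_comp, Category.assoc, h₁₀]
          rw [reassoc_of% hε] }
    refine ⟨Y, ⟨Comonad.algebraIsoMk e ?_ ?_⟩⟩
    · change L.map (adj.unit.app b) ≫ L.map (R.map (L.map ι ≫ α)) = (L.map ι ≫ α) ≫ c
      rw [R.map_comp, L.map_comp, ← L.map_comp_assoc, ← hι, L.map_comp_assoc, h₃, Category.assoc]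
    · change L.map (R.map (L.map ι ≫ α)) ≫ α = L.map (R.map (L.map ι ≫ α) ≫ π) ≫ L.map ι ≫ α
      rw [L.map_comp _ π, Category.assoc, h₉]

end Adjunction

namespace Comonad

variable {C : Type*} [Category C] {G K : Comonad C}

/-- An isomorphism of comonads `G ≅ K` transports algebras over the monad on `G.Coalgebra` to
algebras over the monad on `K.Coalgebra`. -/
def algebraFunctorOfComonadIso (h : G ≅ K) :
    G.adj.toMonad.Algebra ⥤ K.adj.toMonad.Algebra where
  obj X :=
    letI c : X.A.A ⟶ G.obj X.A.A := X.A.a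
    letI α : G.obj X.A.A ⟶ X.A.A := X.a.f
    haveI e (x : C) : h.hom.app x ≫ h.inv.app x = 𝟙 _ :=
      (ComonadIso.toNatIso h).hom_inv_id_app x
    haveI e' (x : C) : h.inv.app x ≫ h.hom.app x = 𝟙 _ :=
      (ComonadIso.toNatIso h).inv_hom_id_app x
    algebraMk _
      { A := X.A.A
        a := c ≫ h.hom.app X.A.A
        counit := by
          rw [Category.assoc, h.hom.app_ε]
          exact X.A.counit
        coassoc := by
          have h₁ : c ≫ G.δ.app X.A.A = c ≫ G.map c := X.A.coassoc
          have h₂ := h.hom.naturality c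
          rw [Category.assoc, Category.assoc, h.hom.app_δ, reassoc_of% h₁, reassoc_of% h₂,
            K.map_comp] }
      (h.inv.app X.A.A ≫ α)
      (by
        have h₁ : G.δ.app X.A.A ≫ G.map α = α ≫ c := algebra_a_h X
        have h₂ := h.hom.naturality α
        have h₃ := h.hom.naturality (h.inv.app X.A.A)
        have h₄ := h.inv.app_δ X.A.A
        change K.δ.app X.A.A ≫ K.map (h.inv.app X.A.A ≫ α) =
          (h.inv.app X.A.A ≫ α) ≫ c ≫ h.hom.app X.A.A
        rw [Category.assoc, ← reassoc_of% h₁, reassoc_of% h₄, h₂, reassoc_of% h₃,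
          reassoc_of% e', K.map_comp])
      (by
        change (c ≫ h.hom.app X.A.A) ≫ h.inv.app X.A.A ≫ α = 𝟙 X.A.A
        rw [Category.assoc, reassoc_of% e]
        exact algebra_unit X)
      (by
        have h₁ : G.map (G.ε.app X.A.A) ≫ α = G.map α ≫ α := algebra_assoc X
        have h₂ := h.inv.naturality α
        have h₃ := h.inv.naturality (G.ε.app X.A.A)
        change K.map (K.ε.app X.A.A) ≫ h.inv.app X.A.A ≫ α =
          K.map (h.inv.app X.A.A ≫ α) ≫ h.inv.app X.A.A ≫ α
        rw [K.map_comp, Category.assoc, reassoc_of% h₂, ← h₁, ← reassoc_of% h₃,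
          ← K.map_comp_assoc, h.inv.app_ε])
  map {X Y} f := algebraHomMk f.f.f
    (by
      let c : X.A.A ⟶ G.obj X.A.A := X.A.a
      let c' : Y.A.A ⟶ G.obj Y.A.A := Y.A.a
      have h₁ : c ≫ G.map f.f.f = f.f.f ≫ c' := f.f.h
      have h₂ := h.hom.naturality f.f.f
      change (c ≫ h.hom.app X.A.A) ≫ K.map f.f.f = f.f.f ≫ c' ≫ h.hom.app Y.A.A
      rw [Category.assoc, ← h₂, reassoc_of% h₁])
    (by
      let α : G.obj X.A.A ⟶ X.A.A := X.a.f
      let α' : G.obj Y.A.A ⟶ Y.A.A := Y.a.f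
      have h₁ : G.map f.f.f ≫ α' = α ≫ f.f.f := algebraHom_h f
      have h₂ := h.inv.naturality f.f.f
      change K.map f.f.f ≫ h.inv.app Y.A.A ≫ α' = (h.inv.app X.A.A ≫ α) ≫ f.f.f
      rw [Category.assoc, ← h₁, reassoc_of% h₂])

/-- Isomorphic comonads have equivalent categories of algebras over their categories of
coalgebras. -/
def algebraEquivOfComonadIso (h : G ≅ K) :
    G.adj.toMonad.Algebra ≌ K.adj.toMonad.Algebra where
  functor := algebraFunctorOfComonadIso h
  inverse := algebraFunctorOfComonadIso h.symm
  unitIso := NatIso.ofComponents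
    (fun X ↦ algebraIsoMk (Iso.refl X.A.A)
      (by
        let c : X.A.A ⟶ G.obj X.A.A := X.A.a
        have e : h.hom.app X.A.A ≫ h.inv.app X.A.A = 𝟙 _ :=
          (ComonadIso.toNatIso h).hom_inv_id_app X.A.A
        change c ≫ G.map (𝟙 X.A.A) = 𝟙 X.A.A ≫ (c ≫ h.hom.app X.A.A) ≫ h.inv.app X.A.A
        rw [Category.assoc, e]
        simp)
      (by
        let α : G.obj X.A.A ⟶ X.A.A := X.a.f
        have e : h.hom.app X.A.A ≫ h.inv.app X.A.A = 𝟙 _ :=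
          (ComonadIso.toNatIso h).hom_inv_id_app X.A.A
        change G.map (𝟙 X.A.A) ≫ h.hom.app X.A.A ≫ h.inv.app X.A.A ≫ α = α ≫ 𝟙 _
        rw [reassoc_of% e]
        simp))
    (fun f ↦ by
      ext
      exact (Category.comp_id _).trans (Category.id_comp _).symm)
  counitIso := NatIso.ofComponents
    (fun X ↦ algebraIsoMk (Iso.refl X.A.A)
      (by
        let c : X.A.A ⟶ K.obj X.A.A := X.A.a
        have e : h.inv.app X.A.A ≫ h.hom.app X.A.A = 𝟙 _ :=
          (ComonadIso.toNatIso h).inv_hom_id_app X.A.A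
        change ((c ≫ h.inv.app X.A.A) ≫ h.hom.app X.A.A) ≫ K.map (𝟙 X.A.A) = 𝟙 X.A.A ≫ c
        rw [Category.assoc, Category.assoc, reassoc_of% e]
        simp)
      (by
        let α : K.obj X.A.A ⟶ X.A.A := X.a.f
        have e : h.inv.app X.A.A ≫ h.hom.app X.A.A = 𝟙 _ :=
          (ComonadIso.toNatIso h).inv_hom_id_app X.A.A
        change K.map (𝟙 X.A.A) ≫ α = (h.inv.app X.A.A ≫ h.hom.app X.A.A ≫ α) ≫ 𝟙 _
        rw [reassoc_of% e]
        simp))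
    (fun f ↦ by
      ext
      exact (Category.comp_id _).trans (Category.id_comp _).symm)
  functor_unitIso_comp X := by
    ext
    exact Category.comp_id _

end Comonad

namespace Adjunction

variable {A B : Type*} [Category A] [Category B] {L : A ⥤ B} {R : B ⥤ A} (adj : L ⊣ R)

instance [IsIdempotentComplete B] : adj.coalgebraComparison.IsEquivalence where

instance [IsIdempotentComplete A] : adj.algebraComparison.IsEquivalence where

end Adjunction

end CategoryTheory

/-- STATEMENT 7: all resolutions of a monad induce equivalent categories of coalgebras: if `B`
and `D` are idempotent complete and the monads `T₁`, `T₂` on `A` induced by two adjunctions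
`L₁ ⊣ R₁ : B → A` and `L₂ ⊣ R₂ : D → A` are isomorphic, then `Coalg(W₁) ≌ Coalg(W₂)`.
Dually, if two adjunctions (out of idempotent complete categories `A₁`, `A₂`) into a common
category `E` induce isomorphic comonads on `E`, then the Eilenberg–Moore categories of algebras
for the two induced monads are equivalent. -/
theorem resolutions_equivalent_coalgebras
    {A B D : Type*} [Category A] [Category B] [Category D]
    [IsIdempotentComplete B] [IsIdempotentComplete D]
    (L₁ : A ⥤ B) (R₁ : B ⥤ A) (adj₁ : L₁ ⊣ R₁)
    (L₂ : A ⥤ D) (R₂ : D ⥤ A) (adj₂ : L₂ ⊣ R₂)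
    {A₁ A₂ E : Type*} [Category A₁] [Category A₂] [Category E]
    [IsIdempotentComplete A₁] [IsIdempotentComplete A₂]
    (M₁ : A₁ ⥤ E) (S₁ : E ⥤ A₁) (badj₁ : M₁ ⊣ S₁)
    (M₂ : A₂ ⥤ E) (S₂ : E ⥤ A₂) (badj₂ : M₂ ⊣ S₂) :
    ((adj₁.toMonad ≅ adj₂.toMonad) →
      Nonempty (adj₁.toComonad.Coalgebra ≌ adj₂.toComonad.Coalgebra)) ∧
    ((badj₁.toComonad ≅ badj₂.toComonad) →
      Nonempty (badj₁.toMonad.Algebra ≌ badj₂.toMonad.Algebra)) := by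
  exact ⟨fun h ↦ ⟨adj₁.coalgebraComparison.asEquivalence.trans
      ((Monad.coalgebraEquivOfMonadIso h).trans adj₂.coalgebraComparison.asEquivalence.symm)⟩,
    fun h ↦ ⟨badj₁.algebraComparison.asEquivalence.trans
      ((Comonad.algebraEquivOfComonadIso h).trans badj₂.algebraComparison.asEquivalence.symm)⟩⟩
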